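/- Let 0 ≤ k₀ ≤ l and let ν = Λ(μ,s,l,ρ,m) − ε(ρ+k₀μ) be the partition obtained by subtracting 1 from part number ρ+k₀μ of Λ(μ,s,l,ρ,m). Then, at κ = −m/(μ+1): (i) h(ν,1) ≠ 0; (ii) if k₀ = l then h(ν,κ+1) ≠ 0; (iii) if 0 ≤ k₀ < l then exactly one of the linear factors of h(ν,κ+1) vanishes at κ = −m/(μ+1), so h(ν,κ+1) ∈ ℚ[κ] has a zero of multiplicity exactly one there; the vanishing factor is the hook length at the node in row ρ+k₀μ and column m(s+l−k₀), which equals (μ+1)κ + m. -/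

import Mathlib

open Finset

/-- Hook-length factor at the node in (0-based) row `i`, (0-based) column `j`. -/
def hookFactor (len : ℕ) (lam : ℕ → ℕ) (t κ : ℚ) (i j : ℕ) : ℚ :=
  (lam i : ℚ) - ((j : ℚ) + 1) + t +
    κ * ((((Finset.range len).filter fun l => i < l ∧ j + 1 ≤ lam l).card : ℚ))

/-- Hook-length product `h(λ, t)`. -/
def hookProd (len : ℕ) (lam : ℕ → ℕ) (t κ : ℚ) : ℚ :=
  ∏ i ∈ Finset.range len, ∏ j ∈ Finset.range (lam i), hookFactor len lam t κ i j

/-- The hook-length product `h(λ, κ+1)` as a polynomial in `κ`: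
each factor `λ_i - j + (κ+1) + κ·(leg count)` is linear in `κ`. -/
noncomputable def hookProdPoly (len : ℕ) (lam : ℕ → ℕ) : Polynomial ℚ :=
  ∏ i ∈ Finset.range len, ∏ j ∈ Finset.range (lam i),
    (Polynomial.C ((lam i : ℚ) - ((j : ℚ) + 1) + 1) +
      Polynomial.C (((((Finset.range len).filter fun l => i < l ∧ j + 1 ≤ lam l).card : ℚ)) + 1) *
        Polynomial.X)

/-- The partition `Λ(μ,s,l,ρ,m)` (0-based indexing of parts). -/
def LamPart (μ s l ρ m : ℕ) : ℕ → ℕ := fun i =>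
  if i < ρ then m * (s + l + 1)
  else if i < ρ + l * μ then m * (s + l - (i - ρ) / μ)
  else 0

/-- `ν = Λ(μ,s,l,ρ,m) - ε(ρ + k₀μ)`: subtract 1 from part number `ρ + k₀μ`
(1-based), i.e. from the part with 0-based index `ρ + k₀μ - 1`. -/
def nuPart (μ s l ρ m k₀ : ℕ) : ℕ → ℕ := fun i =>
  if i = ρ + k₀ * μ - 1 then LamPart μ s l ρ m i - 1 else LamPart μ s l ρ m i

/-- The number of nodes strictly below the node in (0-based) row `i` and column `j`. -/
def legLength (len : ℕ) (lam : ℕ → ℕ) (i j : ℕ) : ℕ :=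
  ((Finset.range len).filter fun l => i < l ∧ j + 1 ≤ lam l).card

theorem hookFactor_eq_legLength (len : ℕ) (lam : ℕ → ℕ) (t κ : ℚ) (i j : ℕ) :
    hookFactor len lam t κ i j =
      (lam i : ℚ) - ((j : ℚ) + 1) + t + κ * (legLength len lam i j : ℚ) := rfl

/-- A vanishing hook length at `κ = -m/(μ+1)` forces divisibility of its arm and leg. -/
theorem exists_of_hookFactor_eq_zero {μ m len i j : ℕ} {lam : ℕ → ℕ} {κ₀ : ℚ} (e : ℕ)
    (hm : 1 ≤ m) (hgcd : Nat.gcd m (μ + 1) = 1) (hκ : κ₀ = -(m : ℚ) / (μ + 1))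
    (hj : j < lam i) (h : hookFactor len lam (e * κ₀ + 1) κ₀ i j = 0) :
    ∃ c, 1 ≤ c ∧ lam i = j + m * c ∧ legLength len lam i j + e = c * (μ + 1) := by
  obtain ⟨d, hd⟩ := Nat.exists_eq_add_of_lt hj
  have hμ0 : (μ : ℚ) + 1 ≠ 0 := by positivity
  have key : (d + 1) * (μ + 1) = m * (legLength len lam i j + e) := by
    rw [hookFactor_eq_legLength, hd, hκ] at h
    push_cast at h
    field_simp at h
    have : (((d + 1) * (μ + 1) : ℕ) : ℚ) = ((m * (legLength len lam i j + e) : ℕ) : ℚ) := by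
      push_cast
      linear_combination h
    exact_mod_cast this
  have hdvd : m ∣ d + 1 :=
    Nat.Coprime.dvd_of_dvd_mul_right hgcd ⟨_, key⟩
  obtain ⟨c, hc⟩ := hdvd
  refine ⟨c, ?_, by omega, ?_⟩
  · rcases Nat.eq_zero_or_pos c with rfl | h0
    · simp at hc
    · exact h0
  · rw [hc, mul_assoc] at key
    exact (Nat.eq_of_mul_eq_mul_left hm key).symm

theorem LamPart_add_le {μ s l ρ m i i' c : ℕ} (hμ : 1 ≤ μ) (hρμ : ρ ≤ μ) (hc : 1 ≤ c)
    (h : i + c * μ ≤ i') (h' : i' < ρ + l * μ) :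
    LamPart μ s l ρ m i' + m * c ≤ LamPart μ s l ρ m i := by
  have hcμ : μ ≤ c * μ := Nat.le_mul_of_pos_left μ hc
  have hq' : (i' - ρ) / μ < l := by
    rw [Nat.div_lt_iff_lt_mul hμ]
    omega
  unfold LamPart
  rw [if_neg (by omega), if_pos h', ← mul_add]
  split_ifs with h1 h2
  · have : c - 1 ≤ (i' - ρ) / μ := by
      rw [Nat.le_div_iff_mul_le hμ, Nat.sub_mul]
      omega
    exact Nat.mul_le_mul_left m (by omega)
  · have : (i - ρ) / μ + c ≤ (i' - ρ) / μ := by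
      rw [← Nat.add_mul_div_right _ _ hμ]
      exact Nat.div_le_div_right (by omega)
    exact Nat.mul_le_mul_left m (by omega)
  · omega

/-- The last part of each block of equal parts of `Λ(μ,s,l,ρ,m)`. -/
theorem LamPart_block_end {μ s l ρ m k : ℕ} (hμ : 1 ≤ μ) (hρ : 1 ≤ ρ) (hk : k ≤ l) :
    LamPart μ s l ρ m (ρ + k * μ - 1) = m * (s + l + 1 - k) := by
  unfold LamPart
  rcases Nat.eq_zero_or_pos k with rfl | h0
  · rw [if_pos (by omega)]
    rfl
  · have hkμ : μ ≤ k * μ := Nat.le_mul_of_pos_left μ h0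
    have hlμ : k * μ ≤ l * μ := Nat.mul_le_mul_right μ hk
    have : (ρ + k * μ - 1 - ρ) / μ = k - 1 := by
      apply Nat.div_eq_of_lt_le
      · rw [Nat.sub_mul]
        omega
      · rw [Nat.sub_add_cancel h0]
        omega
    rw [if_neg (by omega), if_pos (by omega), this]
    congr 1
    omega

theorem LamPart_of_mem_block {μ s l ρ m k i : ℕ} (h1 : ρ + k * μ ≤ i)
    (h2 : i < ρ + (k + 1) * μ) (hk : k < l) :
    LamPart μ s l ρ m i = m * (s + l - k) := by
  have hlμ : (k + 1) * μ ≤ l * μ := Nat.mul_le_mul_right μ hk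
  have : (i - ρ) / μ = k := Nat.div_eq_of_lt_le (by omega) (by omega)
  unfold LamPart
  rw [if_neg (by omega), if_pos (by omega), this]

theorem nuPart_le (μ s l ρ m k i : ℕ) : nuPart μ s l ρ m k i ≤ LamPart μ s l ρ m i := by
  unfold nuPart
  split_ifs <;> omega

theorem nuPart_of_ne {μ s l ρ m k i : ℕ} (h : i ≠ ρ + k * μ - 1) :
    nuPart μ s l ρ m k i = LamPart μ s l ρ m i := if_neg h

theorem nuPart_block_end {μ s l ρ m k : ℕ} (hμ : 1 ≤ μ) (hρ : 1 ≤ ρ) (hk : k ≤ l) :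
    nuPart μ s l ρ m k (ρ + k * μ - 1) = m * (s + l + 1 - k) - 1 := by
  rw [← LamPart_block_end hμ hρ hk]
  exact if_pos rfl

theorem legLength_nuPart_lt {μ s l ρ m k i j c : ℕ} (hμ : 1 ≤ μ) (hρμ : ρ ≤ μ) (hc : 1 ≤ c)
    (h : LamPart μ s l ρ m i = j + m * c) :
    legLength (ρ + l * μ) (nuPart μ s l ρ m k) i j < c * μ := by
  have hcμ : μ ≤ c * μ := Nat.le_mul_of_pos_left μ hc
  have hsub : ((Finset.range (ρ + l * μ)).filter
      fun i' => i < i' ∧ j + 1 ≤ nuPart μ s l ρ m k i') ⊆ Finset.Ioo i (i + c * μ) := by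
    intro i' hi'
    simp only [Finset.mem_filter, Finset.mem_range, Finset.mem_Ioo] at hi' ⊢
    refine ⟨hi'.2.1, ?_⟩
    by_contra! hle
    have h1 := LamPart_add_le (s := s) (m := m) hμ hρμ hc hle hi'.1
    have h2 := nuPart_le μ s l ρ m k i'
    omega
  have := Finset.card_le_card hsub
  rw [Nat.card_Ioo] at this
  unfold legLength
  omega

theorem legLength_nuPart_block_end_le {μ s l ρ m k j c : ℕ} (hμ : 1 ≤ μ) (hρ : 1 ≤ ρ)
    (hm : 1 ≤ m) (hk : k ≤ l) (h : m * (s + l + 1 - k) - 1 = j + m * c) :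
    legLength (ρ + l * μ) (nuPart μ s l ρ m k) (ρ + k * μ - 1) j ≤ c * μ := by
  have hsub : ((Finset.range (ρ + l * μ)).filter
      fun i' => ρ + k * μ - 1 < i' ∧ j + 1 ≤ nuPart μ s l ρ m k i') ⊆
        Finset.Ioc (ρ + k * μ - 1) (ρ + k * μ - 1 + c * μ) := by
    intro i' hi'
    simp only [Finset.mem_filter, Finset.mem_range, Finset.mem_Ioc] at hi' ⊢
    refine ⟨hi'.2.1, ?_⟩
    by_contra! hlt
    have h2 := nuPart_le μ s l ρ m k i'
    have hq : k + c ≤ (i' - ρ) / μ := by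
      rw [Nat.le_div_iff_mul_le hμ, Nat.add_mul]
      omega
    have hL : LamPart μ s l ρ m i' ≤ m * (s + l - (k + c)) := by
      unfold LamPart
      rw [if_neg (by omega), if_pos hi'.1]
      exact Nat.mul_le_mul_left m (by omega)
    have hq' : (i' - ρ) / μ < l := by
      rw [Nat.div_lt_iff_lt_mul hμ]
      omega
    have hsplit : m * (s + l + 1 - k) = m * (s + l - (k + c)) + m * c + m := by
      rw [← mul_add, ← Nat.mul_succ]
      congr 1
      omega
    omega
  have := Finset.card_le_card hsub
  rw [Nat.card_Ioc] at this
  unfold legLength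
  omega

theorem legLength_nuPart_last {μ s l ρ m j : ℕ} :
    legLength (ρ + l * μ) (nuPart μ s l ρ m l) (ρ + l * μ - 1) j = 0 := by
  unfold legLength
  rw [Finset.card_eq_zero, Finset.filter_eq_empty_iff]
  intro i hi
  have := Finset.mem_range.1 hi
  omega

theorem legLength_nuPart_special {μ s l ρ m k : ℕ} (hμ : 1 ≤ μ) (hρ : 1 ≤ ρ)
    (hm : 1 ≤ m) (hk : k < l) :
    legLength (ρ + l * μ) (nuPart μ s l ρ m k) (ρ + k * μ - 1) (m * (s + l - k) - 1) = μ := by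
  have hpos : 1 ≤ m * (s + l - k) := Nat.mul_pos hm (by omega)
  apply le_antisymm
  · have hle := legLength_nuPart_block_end_le (μ := μ) (s := s) (l := l) (ρ := ρ) (m := m)
      (k := k) (j := m * (s + l - k) - 1) (c := 1) hμ hρ hm hk.le (by
        have : m * (s + l + 1 - k) = m * (s + l - k) + m := by
          rw [← Nat.mul_succ]
          congr 1
          omega
        omega)
    rwa [one_mul] at hle
  · have hlμ : (k + 1) * μ ≤ l * μ := Nat.mul_le_mul_right μ hk
    have hkμ : (k + 1) * μ = k * μ + μ := Nat.succ_mul k μ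
    have hsub : Finset.Ioc (ρ + k * μ - 1) (ρ + k * μ - 1 + μ) ⊆
        ((Finset.range (ρ + l * μ)).filter fun i' => ρ + k * μ - 1 < i' ∧
          m * (s + l - k) - 1 + 1 ≤ nuPart μ s l ρ m k i') := by
      intro i' hi'
      simp only [Finset.mem_filter, Finset.mem_range, Finset.mem_Ioc] at hi' ⊢
      refine ⟨by omega, hi'.1, ?_⟩
      rw [nuPart_of_ne (by omega), LamPart_of_mem_block (by omega) (by omega) hk]
      omega
    have := Finset.card_le_card hsub
    rw [Nat.card_Ioc] at this
    unfold legLength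
    omega

theorem hookFactor_nuPart_one_ne_zero {μ s l ρ m k i j : ℕ} {κ₀ : ℚ} (hμ : 1 ≤ μ) (hρ : 1 ≤ ρ)
    (hρμ : ρ ≤ μ) (hm : 1 ≤ m) (hgcd : Nat.gcd m (μ + 1) = 1) (hk : k ≤ l)
    (hκ : κ₀ = -(m : ℚ) / (μ + 1)) (hj : j < nuPart μ s l ρ m k i) :
    hookFactor (ρ + l * μ) (nuPart μ s l ρ m k) 1 κ₀ i j ≠ 0 := by
  intro h
  obtain ⟨c, hc, harm, hleg⟩ :=
    exists_of_hookFactor_eq_zero (μ := μ) 0 hm hgcd hκ hj (by simpa using h)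
  rw [Nat.mul_succ] at hleg
  by_cases hi : i = ρ + k * μ - 1
  · subst hi
    rw [nuPart_block_end hμ hρ hk] at harm
    have := legLength_nuPart_block_end_le hμ hρ hm hk harm
    omega
  · rw [nuPart_of_ne hi] at harm
    have := legLength_nuPart_lt (k := k) hμ hρμ hc harm
    omega

theorem eq_of_hookFactor_nuPart_eq_zero {μ s l ρ m k i j : ℕ} {κ₀ : ℚ} (hμ : 1 ≤ μ)
    (hρ : 1 ≤ ρ) (hρμ : ρ ≤ μ) (hm : 1 ≤ m) (hgcd : Nat.gcd m (μ + 1) = 1) (hk : k ≤ l)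
    (hκ : κ₀ = -(m : ℚ) / (μ + 1)) (hj : j < nuPart μ s l ρ m k i)
    (h : hookFactor (ρ + l * μ) (nuPart μ s l ρ m k) (κ₀ + 1) κ₀ i j = 0) :
    k < l ∧ i = ρ + k * μ - 1 ∧ j = m * (s + l - k) - 1 := by
  obtain ⟨c, hc, harm, hleg⟩ :=
    exists_of_hookFactor_eq_zero (μ := μ) 1 hm hgcd hκ hj (by simpa using h)
  rw [Nat.mul_succ] at hleg
  by_cases hi : i = ρ + k * μ - 1
  · subst hi
    rw [nuPart_block_end hμ hρ hk] at harm
    have hle := legLength_nuPart_block_end_le hμ hρ hm hk harm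
    obtain rfl : c = 1 := by omega
    refine ⟨lt_of_le_of_ne hk ?_, rfl, ?_⟩
    · rintro rfl
      rw [legLength_nuPart_last] at hleg
      omega
    · have : m * (s + l + 1 - k) = m * (s + l - k) + m := by
        rw [← Nat.mul_succ]
        congr 1
        omega
      omega
  · rw [nuPart_of_ne hi] at harm
    have := legLength_nuPart_lt (k := k) hμ hρμ hc harm
    omega

theorem hookFactor_nuPart_special {μ s l ρ m k : ℕ} (hμ : 1 ≤ μ) (hρ : 1 ≤ ρ)
    (hm : 1 ≤ m) (hk : k < l) (κ : ℚ) :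
    hookFactor (ρ + l * μ) (nuPart μ s l ρ m k) (κ + 1) κ
      (ρ + k * μ - 1) (m * (s + l - k) - 1) = ((μ : ℚ) + 1) * κ + (m : ℚ) := by
  have hpos : 1 ≤ m * (s + l - k) := Nat.mul_pos hm (by omega)
  have harm : m * (s + l + 1 - k) - 1 = (m * (s + l - k) - 1) + m := by
    have : m * (s + l + 1 - k) = m * (s + l - k) + m := by
      rw [← Nat.mul_succ]
      congr 1
      omega
    omega
  rw [hookFactor_eq_legLength, legLength_nuPart_special hμ hρ hm hk,
    nuPart_block_end hμ hρ hk.le, harm, Nat.cast_add]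
  ring

theorem hookProd_ne_zero {len : ℕ} {lam : ℕ → ℕ} {t κ : ℚ}
    (h : ∀ i j, j < lam i → hookFactor len lam t κ i j ≠ 0) : hookProd len lam t κ ≠ 0 :=
  Finset.prod_ne_zero_iff.2 fun i _ => Finset.prod_ne_zero_iff.2 fun j hj =>
    h i j (Finset.mem_range.1 hj)

/-- If exactly one factor of `h(λ, κ+1)` vanishes at `κ₀`, then `κ₀` is a simple root. -/
theorem rootMultiplicity_hookProdPoly_eq_one {len : ℕ} {lam : ℕ → ℕ} {κ₀ : ℚ} {i₀ j₀ : ℕ}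
    (hi₀ : i₀ < len) (hj₀ : j₀ < lam i₀)
    (h : ∀ i < len, ∀ j < lam i,
      (hookFactor len lam (κ₀ + 1) κ₀ i j = 0 ↔ i = i₀ ∧ j = j₀)) :
    (hookProdPoly len lam).rootMultiplicity κ₀ = 1 := by
  set f : (Σ _ : ℕ, ℕ) → Polynomial ℚ := fun p =>
    Polynomial.C ((lam p.1 : ℚ) - ((p.2 : ℚ) + 1) + 1) +
      Polynomial.C ((legLength len lam p.1 p.2 : ℚ) + 1) * Polynomial.X with hf
  set S := (Finset.range len).sigma fun i => Finset.range (lam i) with hS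
  have hprod : hookProdPoly len lam = ∏ p ∈ S, f p :=
    (Finset.prod_sigma (Finset.range len) (fun i => Finset.range (lam i)) f).symm
  have heval : ∀ p, (f p).eval κ₀ = hookFactor len lam (κ₀ + 1) κ₀ p.1 p.2 := by
    intro p
    rw [hookFactor_eq_legLength]
    simp only [hf, Polynomial.eval_add, Polynomial.eval_C, Polynomial.eval_mul,
      Polynomial.eval_X]
    ring
  have hmem : (⟨i₀, j₀⟩ : Σ _ : ℕ, ℕ) ∈ S := by simp [hS, hi₀, hj₀]
  have hrest : (∏ p ∈ S.erase ⟨i₀, j₀⟩, f p).eval κ₀ ≠ 0 := by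
    rw [Polynomial.eval_prod]
    refine Finset.prod_ne_zero_iff.2 ?_
    rintro ⟨i, j⟩ hp
    simp only [hS, Finset.mem_erase, Finset.mem_sigma, Finset.mem_range] at hp
    rw [heval]
    intro h0
    obtain ⟨rfl, rfl⟩ := (h i hp.2.1 j hp.2.2).1 h0
    exact hp.1 rfl
  have hrest0 : ∏ p ∈ S.erase ⟨i₀, j₀⟩, f p ≠ 0 := by
    intro h0
    simp [h0] at hrest
  have hlead : (legLength len lam i₀ j₀ : ℚ) + 1 ≠ 0 := by positivity
  have hspecial : f ⟨i₀, j₀⟩ =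
      Polynomial.C ((legLength len lam i₀ j₀ : ℚ) + 1) * (Polynomial.X - Polynomial.C κ₀) := by
    have h0 := (h i₀ hi₀ j₀ hj₀).2 ⟨rfl, rfl⟩
    rw [hookFactor_eq_legLength] at h0
    have hconst : (lam i₀ : ℚ) - ((j₀ : ℚ) + 1) + 1 =
        -(((legLength len lam i₀ j₀ : ℚ) + 1) * κ₀) := by
      linear_combination h0
    simp only [hf, hconst, Polynomial.C_neg, Polynomial.C_mul]
    ring
  have hX : Polynomial.X - Polynomial.C κ₀ ≠ 0 := Polynomial.X_sub_C_ne_zero κ₀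
  have hC : Polynomial.C ((legLength len lam i₀ j₀ : ℚ) + 1) ≠ 0 := Polynomial.C_ne_zero.2 hlead
  rw [hprod, ← Finset.mul_prod_erase S f hmem, hspecial,
    Polynomial.rootMultiplicity_mul (mul_ne_zero (mul_ne_zero hC hX) hrest0),
    Polynomial.rootMultiplicity_mul (mul_ne_zero hC hX), Polynomial.rootMultiplicity_C,
    Polynomial.rootMultiplicity_X_sub_C_self, Polynomial.rootMultiplicity_eq_zero hrest]

/-- for `ν = Λ(μ,s,l,ρ,m) - ε(ρ+k₀μ)`, at `κ₀ = -m/(μ+1)`: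
(i) `h(ν,1) ≠ 0`; (ii) if `k₀ = l` then `h(ν,κ+1) ≠ 0`; (iii) if `k₀ < l` then
exactly one linear factor of `h(ν,κ+1)` vanishes at `κ₀`, namely the hook length at
the node in row `ρ+k₀μ`, column `m(s+l-k₀)` (1-based), which equals `(μ+1)κ + m`;
hence `h(ν,κ+1) ∈ ℚ[κ]` has a zero of multiplicity exactly one at `κ₀`. -/
theorem hook_products_nu (μ s l ρ m k₀ : ℕ)
    (hμ : 1 ≤ μ) (hl : 1 ≤ l) (hρ1 : 1 ≤ ρ) (hρμ : ρ ≤ μ) (hm : 1 ≤ m)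
    (hgcd : Nat.gcd m (μ + 1) = 1) (hk₀ : k₀ ≤ l)
    (κ₀ : ℚ) (hκ : κ₀ = -(m : ℚ) / (μ + 1)) :
    hookProd (ρ + l * μ) (nuPart μ s l ρ m k₀) 1 κ₀ ≠ 0 ∧
    (k₀ = l → hookProd (ρ + l * μ) (nuPart μ s l ρ m k₀) (κ₀ + 1) κ₀ ≠ 0) ∧
    (k₀ < l →
      (∀ i ∈ Finset.range (ρ + l * μ), ∀ j ∈ Finset.range (nuPart μ s l ρ m k₀ i),
        (hookFactor (ρ + l * μ) (nuPart μ s l ρ m k₀) (κ₀ + 1) κ₀ i j = 0 ↔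
          (i = ρ + k₀ * μ - 1 ∧ j = m * (s + l - k₀) - 1))) ∧
      (∀ κ : ℚ, hookFactor (ρ + l * μ) (nuPart μ s l ρ m k₀) (κ + 1) κ
          (ρ + k₀ * μ - 1) (m * (s + l - k₀) - 1) = ((μ : ℚ) + 1) * κ + (m : ℚ)) ∧
      (hookProdPoly (ρ + l * μ) (nuPart μ s l ρ m k₀)).rootMultiplicity κ₀ = 1) := by
  have hsimple : k₀ < l →
      ∀ i < ρ + l * μ, ∀ j < nuPart μ s l ρ m k₀ i,
        (hookFactor (ρ + l * μ) (nuPart μ s l ρ m k₀) (κ₀ + 1) κ₀ i j = 0 ↔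
          (i = ρ + k₀ * μ - 1 ∧ j = m * (s + l - k₀) - 1)) := by
    intro hlt i _ j hj
    refine ⟨fun h =>
      (eq_of_hookFactor_nuPart_eq_zero hμ hρ1 hρμ hm hgcd hk₀ hκ hj h).2, ?_⟩
    rintro ⟨rfl, rfl⟩
    rw [hookFactor_nuPart_special hμ hρ1 hm hlt, hκ]
    field_simp
    ring
  refine ⟨hookProd_ne_zero fun i j hj =>
    hookFactor_nuPart_one_ne_zero hμ hρ1 hρμ hm hgcd hk₀ hκ hj, ?_, ?_⟩
  · intro hkl
    refine hookProd_ne_zero fun i j hj h => ?_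
    have := (eq_of_hookFactor_nuPart_eq_zero hμ hρ1 hρμ hm hgcd hk₀ hκ hj h).1
    omega
  · intro hlt
    refine ⟨fun i hi j hj => hsimple hlt i (Finset.mem_range.1 hi) j (Finset.mem_range.1 hj),
      hookFactor_nuPart_special hμ hρ1 hm hlt,
      rootMultiplicity_hookProdPoly_eq_one ?_ ?_ (hsimple hlt)⟩
    · have := Nat.mul_le_mul_right μ hk₀
      omega
    · have hpos : 1 ≤ m * (s + l - k₀) := Nat.mul_pos hm (by omega)
      have : m * (s + l + 1 - k₀) = m * (s + l - k₀) + m := by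
        rw [← Nat.mul_succ]
        congr 1
        omega
      rw [nuPart_block_end hμ hρ1 hk₀]
      omega
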